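/- Let N be a natural number, and let P = (v_0, ..., v_{q−1}) and P' = (v'_0, ..., v'_{q'−1}) be finite sequences of nodes satisfying: (a) ct(v_i) ≤ rt(v_i) for every node appearing in P or P'; (b) rt(v_i) ≤ ct(v_{i+1}) for all 0 ≤ i < q−1, and rt(v'_i) ≤ ct(v'_{i+1}) for all 0 ≤ i < q'−1; (c) for all 0 ≤ i < min(q, q'), rt(v_i) ≤ max(ct(v_i), ct(v'_i)) and rt(v'_i) ≤ max(ct(v_i), ct(v'_i)). Then the sum of the finite local timers Σ_{i<q} λ̄_{v_i}(N) + Σ_{i<q'} λ̄_{v'_i}(N) is at most N. -/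

import Mathlib

/-- The finite local timer of node `v` as of round `t`:
`λ̄_v(t) = max(min(t, rt v) - ct v, 0)` (truncated subtraction in ℕ). -/
noncomputable def finTimer {ν : Type*} (ct : ν → ℕ) (rt : ν → ℕ∞) (v : ν) (t : ℕ) : ℕ :=
  (min (t : ℕ∞) (rt v)).toNat - ct v

theorem aux_nat (N q q' : ℕ) (C R C' R' : ℕ → ℕ)
    (hR : ∀ i, R i ≤ N) (hR' : ∀ i, R' i ≤ N)
    (hC : ∀ i < q, C i ≤ R i) (hC' : ∀ i < q', C' i ≤ R' i)
    (hb : ∀ i, i + 1 < q → R i ≤ C (i + 1))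
    (hb' : ∀ i, i + 1 < q' → R' i ≤ C' (i + 1))
    (hc : ∀ i, i < q → i < q' → R i ≤ max (C i) (C' i) ∧ R' i ≤ max (C i) (C' i)) (k : ℕ) :
    (∑ i ∈ Finset.range (min k q), (R i - C i)) +
      (∑ i ∈ Finset.range (min k q'), (R' i - C' i)) ≤ N ∧
    (k < q → (∑ i ∈ Finset.range (min k q), (R i - C i)) +
      (∑ i ∈ Finset.range (min k q'), (R' i - C' i)) ≤ C k) ∧
    (k < q' → (∑ i ∈ Finset.range (min k q), (R i - C i)) +
      (∑ i ∈ Finset.range (min k q'), (R' i - C' i)) ≤ C' k) := by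
  induction k with
  | zero => simp
  | succ k ih =>
    have step : ∀ (p : ℕ) (f : ℕ → ℕ), ∑ i ∈ Finset.range (min (k + 1) p), f i =
        ∑ i ∈ Finset.range (min k p), f i + if k < p then f k else 0 := by
      intro p f
      split_ifs with h
      · rw [min_eq_left (by omega), min_eq_left (by omega), Finset.sum_range_succ]
      · rw [min_eq_right (by omega), min_eq_right (by omega), add_zero]
    rw [step, step]
    generalize ∑ i ∈ Finset.range (min k q), (R i - C i) = S at *
    generalize ∑ i ∈ Finset.range (min k q'), (R' i - C' i) = S' at *
    have h1 := hR k
    have h2 := hR' k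
    have h3 := hC k
    have h4 := hC' k
    have h5 := hb k
    have h6 := hb' k
    have h7 := hc k
    by_cases hq : k < q <;> by_cases hq' : k < q' <;> simp only [hq, hq', if_true, if_false] <;>
      simp only [hq, hq', true_implies, false_implies] at h3 h4 h7 ih <;> omega

theorem aux_min (N : ℕ) (x : ℕ∞) (m : ℕ) :
    (x ≤ (m : ℕ∞) → (min (N : ℕ∞) x).toNat ≤ min N m) ∧
    ((m : ℕ∞) ≤ x → min N m ≤ (min (N : ℕ∞) x).toNat) ∧
    (min (N : ℕ∞) x).toNat ≤ N := by
  induction x using ENat.recTopCoe with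
  | top => simp
  | coe a =>
    have : (min (N : ℕ∞) (a : ℕ∞)).toNat = min N a := by
      rw [← ENat.toNat_natCast (min N a)]; norm_cast
    rw [this]
    simp only [Nat.cast_le]
    omega

theorem stmt8 {ν : Type*} (ct : ν → ℕ) (rt : ν → ℕ∞)
    (N q q' : ℕ) (v v' : ℕ → ν)
    (ha : ∀ i < q, (ct (v i) : ℕ∞) ≤ rt (v i))
    (ha' : ∀ i < q', (ct (v' i) : ℕ∞) ≤ rt (v' i))
    (hb : ∀ i, i + 1 < q → rt (v i) ≤ (ct (v (i + 1)) : ℕ∞))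
    (hb' : ∀ i, i + 1 < q' → rt (v' i) ≤ (ct (v' (i + 1)) : ℕ∞))
    (hc : ∀ i < min q q',
      rt (v i) ≤ ((max (ct (v i)) (ct (v' i)) : ℕ) : ℕ∞) ∧
      rt (v' i) ≤ ((max (ct (v i)) (ct (v' i)) : ℕ) : ℕ∞)) :
    (∑ i ∈ Finset.range q, finTimer ct rt (v i) N) +
      (∑ i ∈ Finset.range q', finTimer ct rt (v' i) N) ≤ N := by
  have key := (aux_nat N q q' (fun i => min N (ct (v i)))
    (fun i => (min (N : ℕ∞) (rt (v i))).toNat) (fun i => min N (ct (v' i)))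
    (fun i => (min (N : ℕ∞) (rt (v' i))).toNat)
    (fun i => (aux_min N _ 0).2.2) (fun i => (aux_min N _ 0).2.2)
    (fun i h => (aux_min N _ _).2.1 (ha i h)) (fun i h => (aux_min N _ _).2.1 (ha' i h))
    (fun i h => (aux_min N _ _).1 (hb i h)) (fun i h => (aux_min N _ _).1 (hb' i h))
    (fun i h h' => by
      have h1 := (aux_min N _ _).1 (hc i (lt_min h h')).1
      have h2 := (aux_min N _ _).1 (hc i (lt_min h h')).2
      omega) (q + q')).1
  rw [min_eq_right (by omega), min_eq_right (by omega)] at key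
  have e : ∀ u, finTimer ct rt u N = (min (N : ℕ∞) (rt u)).toNat - min N (ct u) := by
    intro u
    have := (aux_min N (rt u) 0).2.2
    unfold finTimer
    omega
  simp only [e]
  exact key
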